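/- Let f: (M, g) → (N, h) be a holomorphic map between Hermitian manifolds, and set u = tr_{ω_g}(f^*ω_h). Then in local holomorphic coordinates {z^i} on M and {w^α} on N, with f^α_i = ∂f^α/∂z^i, one has the identities ∂∂̄u = ⟨∇df, ∇df⟩ + ( R^g_{ij̄kl̄} g^{kq̄} g^{pl̄} h_{αβ̄} f^α_p \overline{f^β_q} − R^h_{αβ̄γδ̄} (f^α_i \overline{f^β_j}) (g^{pq̄} f^γ_p \overline{f^δ_q}) ) dz^i ∧ dz̄^j and Δ_g u = |∇df|^2 + (g^{ij̄} R^g_{ij̄kl̄}) g^{kq̄} g^{pl̄} h_{αβ̄} f^α_p \overline{f^β_q} − R^h_{αβ̄γδ̄} (g^{ij̄} f^α_i \overline{f^β_j}) (g^{pq̄} f^γ_p \overline{f^δ_q}), where ∇ is the connection on T^*_M ⊗ f^*(T_N) induced by the Chern connections of g and h. -/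

import Mathlib

/-!
**Lemma 4.1 (Yau's Schwarz calculation)** of X. Yang, "RC-positivity, vanishing
theorems and rigidity of holomorphic maps", stated in local holomorphic coordinates.

We work in a local chart: the source is an open set `Ω ⊆ ℂ^m` with coordinates
`z^i`, the target an open set `D ⊆ ℂ^n` with coordinates `w^α`; a Hermitian metric
is recorded by its matrix of components (`g z k l = g_{k l̄}(z)`, together with the
matrix of components of its inverse), and all differential operators are expressed
through Wirtinger derivatives.
-/

noncomputable section

namespace YauSchwarz

open scoped BigOperators

/-- The Wirtinger derivative `∂F/∂z^i = ½(∂F/∂x^i − √−1 ∂F/∂y^i)`. -/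
def dz {m : ℕ} (i : Fin m) (F : (Fin m → ℂ) → ℂ) (z : Fin m → ℂ) : ℂ :=
  ((fderiv ℝ F z) (Pi.single i 1) - Complex.I * (fderiv ℝ F z) (Pi.single i Complex.I)) / 2

/-- The Wirtinger derivative `∂F/∂z̄^j = ½(∂F/∂x^j + √−1 ∂F/∂y^j)`. -/
def dzbar {m : ℕ} (j : Fin m) (F : (Fin m → ℂ) → ℂ) (z : Fin m → ℂ) : ℂ :=
  ((fderiv ℝ F z) (Pi.single j 1) + Complex.I * (fderiv ℝ F z) (Pi.single j Complex.I)) / 2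

/-- The Chern curvature of a Hermitian metric `g` (with inverse matrix `gInv`):
`R_{i j̄ k l̄} = − ∂²g_{k l̄}/∂z^i ∂z̄^j + ∑_{p,q} g^{p q̄} (∂ g_{k q̄}/∂z^i)(∂ g_{p l̄}/∂z̄^j)`. -/
def chern {m : ℕ} (g gInv : (Fin m → ℂ) → Fin m → Fin m → ℂ) (i j k l : Fin m)
    (z : Fin m → ℂ) : ℂ :=
  - dz i (fun z' => dzbar j (fun z'' => g z'' k l) z') z
    + ∑ p, ∑ q, gInv z p q * dz i (fun z' => g z' k q) z * dzbar j (fun z' => g z' p l) z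

/-- `f^α_i = ∂f^α/∂z^i` for a (holomorphic) map `f`. -/
def fd {m n : ℕ} (f : (Fin m → ℂ) → Fin n → ℂ) (α : Fin n) (i : Fin m)
    (z : Fin m → ℂ) : ℂ :=
  dz i (fun z' => f z' α) z

/-- The Christoffel symbols `Γ^k_{ip} = ∑_l g^{k l̄} ∂ g_{p l̄}/∂z^i` of the Chern
connection of `g`. -/
def christoffel {m : ℕ} (g gInv : (Fin m → ℂ) → Fin m → Fin m → ℂ) (k i p : Fin m)
    (z : Fin m → ℂ) : ℂ :=
  ∑ l, gInv z k l * dz i (fun z' => g z' p l) z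

/-- The components `(∇ df)^α_{ip}` of the covariant derivative of `df`, where `∇` is the
connection on `T^*_M ⊗ f^*(T_N)` induced by the Chern connections of `g` and `h`:
`(∇ df)^α_{ip} = ∂_i f^α_p − Γ^k_{ip} f^α_k + Γ^α_{γδ}(f) f^γ_i f^δ_p`. -/
def nablaDf {m n : ℕ} (g gInv : (Fin m → ℂ) → Fin m → Fin m → ℂ)
    (h hInv : (Fin n → ℂ) → Fin n → Fin n → ℂ)
    (f : (Fin m → ℂ) → Fin n → ℂ) (α : Fin n) (i p : Fin m) (z : Fin m → ℂ) : ℂ :=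
  dz i (fun z' => fd f α p z') z
    - ∑ k, christoffel g gInv k i p z * fd f α k z
    + ∑ γ, ∑ δ, christoffel h hInv α γ δ (f z) * fd f γ i z * fd f δ p z

/-- `u = tr_{ω_g}(f^*ω_h) = ∑ g^{i j̄} h_{α β̄}(f) f^α_i \overline{f^β_j}`. -/
def energy {m n : ℕ} (gInv : (Fin m → ℂ) → Fin m → Fin m → ℂ)
    (h : (Fin n → ℂ) → Fin n → Fin n → ℂ)
    (f : (Fin m → ℂ) → Fin n → ℂ) (z : Fin m → ℂ) : ℂ :=
  ∑ i, ∑ j, ∑ α, ∑ β, gInv z i j * h (f z) α β * fd f α i z * star (fd f β j z)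

/-- The components `⟨∇df, ∇df⟩_{i j̄} = ∑ g^{p q̄} h_{α β̄}(f) (∇df)^α_{ip}
\overline{(∇df)^β_{jq}}` of the `(1,1)`-form `⟨∇df, ∇df⟩`. -/
def nablaDfSq {m n : ℕ} (g gInv : (Fin m → ℂ) → Fin m → Fin m → ℂ)
    (h hInv : (Fin n → ℂ) → Fin n → Fin n → ℂ)
    (f : (Fin m → ℂ) → Fin n → ℂ) (i j : Fin m) (z : Fin m → ℂ) : ℂ :=
  ∑ p, ∑ q, ∑ α, ∑ β, gInv z p q * h (f z) α β
    * nablaDf g gInv h hInv f α i p z * star (nablaDf g gInv h hInv f β j q z)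


theorem holo_fderiv_apply {E : Type*} [NormedAddCommGroup E] [NormedSpace ℂ E]
    [FiniteDimensional ℂ E]
    {φ : E → ℂ} {U : Set E} (hU : IsOpen U) (hφ : DifferentiableOn ℂ φ U) (v : E) :
    DifferentiableOn ℂ (fun z => fderiv ℂ φ z v) U := by
  have : ProperSpace E := FiniteDimensional.proper ℂ E
  let : MeasurableSpace E := borel E
  have : BorelSpace E := ⟨rfl⟩
  intro z₀ hz₀
  apply DifferentiableAt.differentiableWithinAt
  obtain ⟨R, hR, hRU⟩ := Metric.nhds_basis_closedBall.mem_iff.1 (hU.mem_nhds hz₀)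
  set r := R / 3 with hr
  have hr0 : 0 < r := by positivity
  obtain ⟨C, hC⟩ := (isCompact_closedBall z₀ R).exists_bound_of_continuousOn
    (hφ.continuousOn.mono hRU)
  set ρ := r / (‖v‖ + 1) with hρ
  have hρ0 : 0 < ρ := by positivity
  have hρv : ρ * ‖v‖ < r := by
    have : ρ * (‖v‖ + 1) = r := by rw [hρ]; field_simp
    nlinarith
  have hmem : ∀ z ∈ Metric.ball z₀ r, ∀ ζ : ℂ, ‖ζ‖ ≤ ρ → z + ζ • v ∈ Metric.ball z₀ (2 * r) := by
    intro z hz ζ hζ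
    rw [mem_ball_iff_norm] at hz ⊢
    have h1 : ‖ζ • v‖ ≤ ρ * ‖v‖ := by rw [norm_smul]; gcongr
    have h2 : z + ζ • v - z₀ = (z - z₀) + ζ • v := by abel
    rw [h2]
    linarith [norm_add_le (z - z₀) (ζ • v)]
  have hUU : Metric.ball z₀ (2 * r) ⊆ U := fun y hy => hRU
    (Metric.closedBall_subset_closedBall (by linarith) (Metric.ball_subset_closedBall hy))
  have hbd : ∀ y ∈ Metric.ball z₀ (2 * r), ‖fderiv ℂ φ y‖ ≤ 2 * C / r := by
    intro y hy
    have hsub : Metric.ball y r ⊆ Metric.closedBall z₀ R := by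
      intro x hx
      rw [Metric.mem_ball] at hx hy
      rw [Metric.mem_closedBall]
      linarith [dist_triangle x y z₀]
    refine Complex.norm_fderiv_le_div_of_mapsTo_ball (hφ.mono (hsub.trans hRU)) ?_ hr0
    intro x hx
    rw [mem_closedBall_iff_norm]
    have h1 := hC x (hsub hx)
    have h2 := hC y (hsub (Metric.mem_ball_self hr0))
    linarith [norm_sub_le (φ x) (φ y)]
  have hform : ∀ z ∈ Metric.ball z₀ r, fderiv ℂ φ z v =
      (2 * Real.pi * Complex.I : ℂ)⁻¹ • ∫ θ in (0:ℝ)..2 * Real.pi,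
        (deriv (circleMap 0 ρ) θ * ((circleMap 0 ρ θ - 0) ^ 2)⁻¹) • φ (z + circleMap 0 ρ θ • v) := by
    intro z hz
    have hzU : z ∈ U := by
      have := hmem z hz 0 (by simpa using hρ0.le)
      simp only [zero_smul, add_zero] at this
      exact hUU this
    have hcont : Continuous (fun ζ : ℂ => z + ζ • v) := by fun_prop
    have hd : DifferentiableOn ℂ (fun ζ : ℂ => φ (z + ζ • v)) ((fun ζ : ℂ => z + ζ • v) ⁻¹' U) := by
      refine hφ.comp ?_ (Set.mapsTo_preimage _ _)
      fun_prop
    have h1 := Complex.two_pi_I_inv_smul_circleIntegral_sub_sq_inv_smul_of_differentiable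
      (hU.preimage hcont) (c := 0) (w₀ := 0) (R := ρ) (fun ζ hζ => hUU (hmem z hz ζ (by simpa using hζ)))
      hd (Metric.mem_ball_self hρ0)
    have h2 : HasDerivAt (fun ζ : ℂ => φ (z + ζ • v)) (fderiv ℂ φ z v) 0 := by
      have h3 : HasDerivAt (fun ζ : ℂ => z + ζ • v) v 0 := by
        simpa using ((hasDerivAt_id (0:ℂ)).smul_const v).const_add z
      have h4 : HasFDerivAt φ (fderiv ℂ φ z) (z + (0:ℂ) • v) := by
        simpa using (hφ.differentiableAt (hU.mem_nhds hzU)).hasFDerivAt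
      exact h4.comp_hasDerivAt (0:ℂ) h3
    rw [← h2.deriv, ← h1]
    congr 1
    simp only [circleIntegral, smul_smul]
  have hcm : ∀ θ, ‖circleMap 0 ρ θ‖ = ρ := by
    intro θ; simp [abs_of_pos hρ0]
  have hcm0 : ∀ θ, circleMap 0 ρ θ ≠ 0 := by
    intro θ h; have := hcm θ; rw [h] at this; simp at this; linarith
  set c : ℝ → ℂ := fun θ => deriv (circleMap 0 ρ) θ * ((circleMap 0 ρ θ - 0) ^ 2)⁻¹ with hc
  have hcc : Continuous c := by
    rw [hc]
    simp only [deriv_circleMap, sub_zero]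
    refine Continuous.mul (by fun_prop) (Continuous.inv₀ (by fun_prop) ?_)
    intro θ; exact pow_ne_zero _ (hcm0 θ)
  have hFc : ∀ z ∈ Metric.ball z₀ r, Continuous (fun θ => c θ • φ (z + circleMap 0 ρ θ • v)) := by
    intro z hz
    refine hcc.smul ?_
    refine hφ.continuousOn.comp_continuous (by fun_prop) ?_
    intro θ
    exact hUU (hmem z hz _ (hcm θ).le)
  have key := intervalIntegral.hasFDerivAt_integral_of_dominated_of_fderiv_le (𝕜 := ℂ)
    (μ := MeasureTheory.volume) (a := 0) (b := 2 * Real.pi) (s := Metric.ball z₀ r) (x₀ := z₀)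
    (F := fun z θ => c θ • φ (z + circleMap 0 ρ θ • v))
    (F' := fun z θ => c θ • fderiv ℂ φ (z + circleMap 0 ρ θ • v))
    (bound := fun θ => ‖c θ‖ * (2 * C / r))
    (Metric.ball_mem_nhds _ hr0) ?_ ?_ ?_ ?_ ?_ ?_
  · have : (fun z => fderiv ℂ φ z v) =ᶠ[nhds z₀] _ :=
      Filter.eventuallyEq_of_mem (Metric.ball_mem_nhds z₀ hr0) hform
    rw [this.differentiableAt_iff]
    exact key.differentiableAt.const_smul ((2 * Real.pi * Complex.I : ℂ)⁻¹)
  · filter_upwards [Metric.ball_mem_nhds z₀ hr0] with z hz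
    exact (hFc z hz).aestronglyMeasurable
  · exact (hFc z₀ (Metric.mem_ball_self hr0)).intervalIntegrable _ _
  · have hm : Measurable (fun θ => fderiv ℂ φ (z₀ + circleMap 0 ρ θ • v)) := by
      refine (measurable_fderiv ℂ φ).comp ?_
      exact Continuous.measurable (by fun_prop)
    exact (hcc.aestronglyMeasurable.smul hm.aestronglyMeasurable)
  · refine Filter.Eventually.of_forall fun θ _ x hx => ?_
    rw [norm_smul]
    gcongr
    exact hbd _ (hmem x hx _ (hcm θ).le)
  · exact Continuous.intervalIntegrable (by fun_prop) _ _
  · refine Filter.Eventually.of_forall fun θ _ x hx => ?_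
    have h4 := (hφ.differentiableAt (hU.mem_nhds (hUU (hmem x hx _ (hcm θ).le)))).hasFDerivAt
    exact ((h4.comp x ((hasFDerivAt_id x).add_const _))).const_smul (c θ)

theorem holo_contDiffOn {E : Type*} [NormedAddCommGroup E] [NormedSpace ℂ E]
    [FiniteDimensional ℂ E] {U : Set E} (hU : IsOpen U) (n : ℕ) :
    ∀ {φ : E → ℂ}, DifferentiableOn ℂ φ U → ContDiffOn ℂ n φ U := by
  induction n with
  | zero => intro φ hφ; simpa using hφ.continuousOn
  | succ k ih =>
    intro φ hφ
    push_cast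
    rw [contDiffOn_succ_iff_fderiv_of_isOpen hU]
    refine ⟨hφ, by simp, ?_⟩
    rw [contDiffOn_clm_apply]
    intro y
    exact ih (holo_fderiv_apply hU hφ y)

theorem holo_smooth {E : Type*} [NormedAddCommGroup E] [NormedSpace ℂ E]
    [FiniteDimensional ℂ E] {U : Set E} (hU : IsOpen U)
    {φ : E → ℂ} (h : DifferentiableOn ℂ φ U) : ContDiffOn ℝ (⊤ : ℕ∞) φ U := by
  rw [contDiffOn_infty]
  intro n
  exact (holo_contDiffOn hU n h).restrict_scalars ℝ

/-- Common form of the two Wirtinger derivatives. -/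
def W {m : ℕ} (s : ℂ) (i : Fin m) (F : (Fin m → ℂ) → ℂ) (z : Fin m → ℂ) : ℂ :=
  ((fderiv ℝ F z) (Pi.single i 1) + s * (fderiv ℝ F z) (Pi.single i Complex.I)) / 2

theorem dz_eq {m : ℕ} (i : Fin m) : dz i = W (-Complex.I) i := by
  funext F z; simp only [dz, W]; ring

theorem dzbar_eq {m : ℕ} (i : Fin m) : dzbar i = W Complex.I i := rfl

section Wirt
variable {m n : ℕ} {z : Fin m → ℂ} {F G : (Fin m → ℂ) → ℂ} (s : ℂ) (i : Fin m)

theorem W_congr {Ω : Set (Fin m → ℂ)} (hΩ : IsOpen Ω) (hz : z ∈ Ω) (h : Set.EqOn F G Ω) :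
    W s i F z = W s i G z := by
  have : F =ᶠ[nhds z] G := Filter.eventuallyEq_of_mem (hΩ.mem_nhds hz) h
  simp only [W, this.fderiv_eq]

theorem W_const (c : ℂ) : W s i (fun _ => c) z = 0 := by
  simp [W]

theorem W_add (hF : DifferentiableAt ℝ F z) (hG : DifferentiableAt ℝ G z) :
    W s i (fun z => F z + G z) z = W s i F z + W s i G z := by
  simp only [W]
  rw [fderiv_fun_add hF hG]
  simp only [add_apply]; ring

theorem W_neg : W s i (fun z => - F z) z = - W s i F z := by
  simp only [W]
  rw [fderiv_fun_neg]
  simp only [neg_apply]; ring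

theorem W_mul (hF : DifferentiableAt ℝ F z) (hG : DifferentiableAt ℝ G z) :
    W s i (fun z => F z * G z) z = W s i F z * G z + F z * W s i G z := by
  simp only [W]
  rw [fderiv_fun_mul hF hG]
  simp only [add_apply, smul_apply, smul_eq_mul]; ring

theorem W_sum {ι : Type*} (t : Finset ι) {X : ι → (Fin m → ℂ) → ℂ}
    (hX : ∀ a ∈ t, DifferentiableAt ℝ (X a) z) :
    W s i (fun z => ∑ a ∈ t, X a z) z = ∑ a ∈ t, W s i (X a) z := by
  simp only [W]
  rw [fderiv_fun_sum hX]
  simp only [sum_apply, Finset.mul_sum, ← Finset.sum_add_distrib, Finset.sum_div]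

theorem W_star : W s i (fun z => star (F z)) z = star (W (star s) i F z) := by
  simp only [W]
  rw [fderiv_star]
  simp [star_div₀]

theorem W_smooth {Ω : Set (Fin m → ℂ)} (hΩ : IsOpen Ω) (hF : ContDiffOn ℝ (⊤ : ℕ∞) F Ω) :
    ContDiffOn ℝ (⊤ : ℕ∞) (W s i F) Ω := by
  have h1 := ((contDiffOn_infty_iff_fderiv_of_isOpen hΩ).1 hF).2
  unfold W
  have h2 : ∀ v, ContDiffOn ℝ (⊤ : ℕ∞) (fun z => fderiv ℝ F z v) Ω := fun v =>
    h1.clm_apply contDiffOn_const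
  exact ((h2 _).add (contDiffOn_const.mul (h2 _))).div_const 2

theorem holo_fderiv_real (h : DifferentiableAt ℂ F z) (v : Fin m → ℂ) :
    fderiv ℝ F z v = fderiv ℂ F z v := by
  rw [h.fderiv_restrictScalars ℝ]; rfl

theorem single_I : (Pi.single i Complex.I : Fin m → ℂ) = Complex.I • Pi.single i (1:ℂ) := by
  rw [← Pi.single_smul]; simp

theorem W_holo (h : DifferentiableAt ℂ F z) : W (-Complex.I) i F z = fderiv ℂ F z (Pi.single i 1) := by
  simp only [W, holo_fderiv_real h, single_I, map_smul, smul_eq_mul]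
  linear_combination (-(fderiv ℂ F z) (Pi.single i 1) / 2) * Complex.I_mul_I

theorem W_bar_holo (h : DifferentiableAt ℂ F z) : W Complex.I i F z = 0 := by
  simp only [W, holo_fderiv_real h, single_I, map_smul, smul_eq_mul]
  linear_combination ((fderiv ℂ F z) (Pi.single i 1) / 2) * Complex.I_mul_I

theorem W_holo_holo {Ω : Set (Fin m → ℂ)} (hΩ : IsOpen Ω) (hF : DifferentiableOn ℂ F Ω) :
    DifferentiableOn ℂ (W (-Complex.I) i F) Ω :=
  (holo_fderiv_apply hΩ hF (Pi.single i 1)).congr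
    fun _ hz => W_holo i (hF.differentiableAt (hΩ.mem_nhds hz))

/-- A real-linear map in terms of its Wirtinger components. -/
theorem real_lin (T : (Fin n → ℂ) →L[ℝ] ℂ) (v : Fin n → ℂ) :
    T v = ∑ a, (((T (Pi.single a 1) + (-Complex.I) * T (Pi.single a Complex.I)) / 2) * v a
      + ((T (Pi.single a 1) + Complex.I * T (Pi.single a Complex.I)) / 2) * star (v a)) := by
  have hv : v = ∑ a, ((v a).re • (Pi.single a 1 : Fin n → ℂ)
      + (v a).im • (Pi.single a Complex.I : Fin n → ℂ)) := by
    funext b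
    simp only [Finset.sum_apply, Pi.add_apply, Pi.smul_apply, Pi.single_apply]
    simp [Complex.re_add_im, Finset.sum_add_distrib]
  conv_lhs => rw [hv]
  rw [map_sum]
  refine Finset.sum_congr rfl fun a _ => ?_
  rw [map_add, map_smul, map_smul]
  have h1 : v a = (v a).re + (v a).im * Complex.I := (Complex.re_add_im _).symm
  have h2 : star (v a) = (v a).re - (v a).im * Complex.I := by
    apply Complex.ext <;> simp
  rw [h2]
  conv_rhs => rw [h1]
  simp only [Complex.add_re, Complex.ofReal_re, Complex.mul_re, Complex.I_re, Complex.ofReal_im,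
    Complex.I_im, Complex.add_im, Complex.mul_im, Complex.real_smul]
  push_cast
  linear_combination (((v a).im : ℂ) * T (Pi.single a Complex.I)) * Complex.I_mul_I

theorem W_comp {f : (Fin m → ℂ) → Fin n → ℂ} {φ : (Fin n → ℂ) → ℂ}
    (hf : DifferentiableAt ℂ f z) (hφ : DifferentiableAt ℝ φ (f z)) :
    W s i (fun z => φ (f z)) z = ∑ a, (W (-Complex.I) a φ (f z) * W s i (fun z => f z a) z
      + W Complex.I a φ (f z) * W s i (fun z => star (f z a)) z) := by
  have hfr : DifferentiableAt ℝ f z := hf.restrictScalars ℝ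
  have h1 : fderiv ℝ (fun z => φ (f z)) z = (fderiv ℝ φ (f z)).comp (fderiv ℝ f z) :=
    fderiv_comp z hφ hfr
  have h2 : ∀ a v, fderiv ℝ (fun z => f z a) z v = fderiv ℝ f z v a := by
    intro a v
    have := (hasFDerivAt_pi'.1 hfr.hasFDerivAt a).fderiv
    rw [this]; rfl
  have h3 : ∀ a v, fderiv ℝ (fun z => star (f z a)) z v = star (fderiv ℝ f z v a) := by
    intro a v
    rw [fderiv_star]; simp [h2]
  simp only [W, h1, h2, h3, ContinuousLinearMap.comp_apply]
  rw [real_lin (fderiv ℝ φ (f z)) (fderiv ℝ f z (Pi.single i 1)),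
    real_lin (fderiv ℝ φ (f z)) (fderiv ℝ f z (Pi.single i Complex.I)), Finset.mul_sum,
    ← Finset.sum_add_distrib, Finset.sum_div]
  refine Finset.sum_congr rfl fun a _ => ?_
  ring

end Wirt

/-- Entrywise Wirtinger derivative of a matrix valued function. -/
def MW {m a b : ℕ} (s : ℂ) (i : Fin m) (A : (Fin m → ℂ) → Matrix (Fin a) (Fin b) ℂ)
    (z : Fin m → ℂ) : Matrix (Fin a) (Fin b) ℂ :=
  Matrix.of fun x y => W s i (fun z' => A z' x y) z

/-- Entrywise smoothness of a matrix valued function. -/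
def Sm {m a b : ℕ} (Ω : Set (Fin m → ℂ)) (A : (Fin m → ℂ) → Matrix (Fin a) (Fin b) ℂ) : Prop :=
  ∀ x y, ContDiffOn ℝ (⊤ : ℕ∞) (fun z => A z x y) Ω

/-- Entrywise holomorphy of a matrix valued function. -/
def Hol {m a b : ℕ} (Ω : Set (Fin m → ℂ)) (A : (Fin m → ℂ) → Matrix (Fin a) (Fin b) ℂ) : Prop :=
  ∀ x y, DifferentiableOn ℂ (fun z => A z x y) Ω

section Mat
variable {m a b c : ℕ} {Ω : Set (Fin m → ℂ)} {z : Fin m → ℂ} (s : ℂ) (i : Fin m)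
  {A A' : (Fin m → ℂ) → Matrix (Fin a) (Fin b) ℂ} {B : (Fin m → ℂ) → Matrix (Fin b) (Fin c) ℂ}

theorem Sm.diff (hA : Sm Ω A) (hΩ : IsOpen Ω) (hz : z ∈ Ω) (x y) :
    DifferentiableAt ℝ (fun z => A z x y) z :=
  ((hA x y).differentiableOn (by simp)).differentiableAt (hΩ.mem_nhds hz)

theorem Sm.mul (hA : Sm Ω A) (hB : Sm Ω B) : Sm Ω (fun z => A z * B z) := by
  intro x y
  simp only [Matrix.mul_apply]
  exact ContDiffOn.sum fun k _ => (hA x k).mul (hB k y)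

theorem Sm.add (hA : Sm Ω A) (hB : Sm Ω A') : Sm Ω (fun z => A z + A' z) := by
  intro x y
  simp only [Matrix.add_apply]
  exact (hA x y).add (hB x y)

theorem Sm.MW (hA : Sm Ω A) (hΩ : IsOpen Ω) : Sm Ω (MW s i A) := fun x y =>
  W_smooth s i hΩ (hA x y)

theorem Sm.conj (hA : Sm Ω A) : Sm Ω (fun z => (A z).conjTranspose) := by
  intro x y
  simp only [Matrix.conjTranspose_apply]
  exact (Complex.conjCLE.contDiff (n := (⊤ : ℕ∞))).comp_contDiffOn (hA y x)

theorem Hol.sm (hA : Hol Ω A) (hΩ : IsOpen Ω) : Sm Ω A := fun x y => holo_smooth hΩ (hA x y)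

theorem Hol.MW (hA : Hol Ω A) (hΩ : IsOpen Ω) : Hol Ω (MW (-Complex.I) i A) := fun x y =>
  W_holo_holo i hΩ (hA x y)

theorem MW_congr (hΩ : IsOpen Ω) (hz : z ∈ Ω) (h : Set.EqOn A A' Ω) :
    MW s i A z = MW s i A' z := by
  ext x y
  exact W_congr s i hΩ hz fun z' hz' => by simp only [h hz']

theorem MW_mul (hA : Sm Ω A) (hB : Sm Ω B) (hΩ : IsOpen Ω) (hz : z ∈ Ω) :
    MW s i (fun z => A z * B z) z = MW s i A z * B z + A z * MW s i B z := by
  ext x y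
  simp only [MW, Matrix.add_apply, Matrix.mul_apply, Matrix.of_apply]
  rw [W_sum s i _ fun k _ => (hA.diff hΩ hz x k).fun_mul (hB.diff hΩ hz k y), ← Finset.sum_add_distrib]
  refine Finset.sum_congr rfl fun k _ => ?_
  exact W_mul s i (hA.diff hΩ hz x k) (hB.diff hΩ hz k y)

theorem MW_add (hA : Sm Ω A) (hB : Sm Ω A') (hΩ : IsOpen Ω) (hz : z ∈ Ω) :
    MW s i (fun z => A z + A' z) z = MW s i A z + MW s i A' z := by
  ext x y
  exact W_add s i (hA.diff hΩ hz x y) (hB.diff hΩ hz x y)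

theorem MW_neg : MW s i (fun z => - A z) z = - MW s i A z := by
  ext x y
  exact W_neg s i

theorem MW_const (C : Matrix (Fin a) (Fin b) ℂ) : MW s i (fun _ => C) z = 0 := by
  ext x y
  exact W_const s i _

theorem MW_trace {A : (Fin m → ℂ) → Matrix (Fin a) (Fin a) ℂ}
    (hA : Sm Ω A) (hΩ : IsOpen Ω) (hz : z ∈ Ω) :
    W s i (fun z => (A z).trace) z = (MW s i A z).trace := by
  simp only [Matrix.trace, Matrix.diag]
  rw [W_sum s i _ fun k _ => hA.diff hΩ hz k k]
  rfl

theorem MW_conj : MW s i (fun z => (A z).conjTranspose) z = (MW (star s) i A z).conjTranspose := by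
  ext x y
  exact W_star s i

theorem MW_holo (hA : Hol Ω A) (hΩ : IsOpen Ω) (hz : z ∈ Ω) : MW Complex.I i A z = 0 := by
  ext x y
  exact W_bar_holo i ((hA x y).differentiableAt (hΩ.mem_nhds hz))

theorem MW_conj_holo (hA : Hol Ω A) (hΩ : IsOpen Ω) (hz : z ∈ Ω) :
    MW (-Complex.I) i (fun z => (A z).conjTranspose) z = 0 := by
  rw [MW_conj]
  have : star (-Complex.I) = Complex.I := by simp
  rw [this, MW_holo i hA hΩ hz, Matrix.conjTranspose_zero]

/-- Derivative of the inverse. -/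
theorem MW_inv {K G : (Fin m → ℂ) → Matrix (Fin a) (Fin a) ℂ} (hK : Sm Ω K) (hG : Sm Ω G)
    (hKG : ∀ z ∈ Ω, K z * G z = 1) (hΩ : IsOpen Ω) (hz : z ∈ Ω) :
    MW s i K z = - (K z * MW s i G z * K z) := by
  have h1 : MW s i (fun z => K z * G z) z = 0 := by
    rw [MW_congr s i hΩ hz (A' := fun _ => 1) hKG, MW_const]
  rw [MW_mul s i hK hG hΩ hz] at h1
  have hGK : G z * K z = 1 := mul_eq_one_comm.1 (hKG z hz)
  have h2 : MW s i K z * G z = - (K z * MW s i G z) := eq_neg_of_add_eq_zero_left h1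
  calc MW s i K z = MW s i K z * G z * K z := by rw [Matrix.mul_assoc, hGK, Matrix.mul_one]
    _ = _ := by rw [h2, Matrix.neg_mul]

theorem MW_inv2 {K G : (Fin m → ℂ) → Matrix (Fin a) (Fin a) ℂ} (hK : Sm Ω K) (hG : Sm Ω G)
    (hKG : ∀ z ∈ Ω, K z * G z = 1) (hΩ : IsOpen Ω) (hz : z ∈ Ω) (t : ℂ) (j : Fin m) :
    MW s i (MW t j K) z = K z * MW s i G z * K z * MW t j G z * K z
      + K z * MW t j G z * K z * MW s i G z * K z - K z * MW s i (MW t j G) z * K z := by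
  rw [MW_congr s i hΩ hz (A' := fun z => - (K z * MW t j G z * K z))
    (fun z' hz' => MW_inv t j hK hG hKG hΩ hz'), MW_neg,
    MW_mul s i (hK.mul (hG.MW t j hΩ)) hK hΩ hz, MW_mul s i hK (hG.MW t j hΩ) hΩ hz,
    MW_inv s i hK hG hKG hΩ hz]
  noncomm_ring

/-- Smoothness of the inverse. -/
theorem Sm_inv {K G : (Fin m → ℂ) → Matrix (Fin a) (Fin a) ℂ} (hG : Sm Ω G)
    (hKG : ∀ z ∈ Ω, K z * G z = 1) : Sm Ω K := by
  have hdet : ContDiffOn ℝ (⊤ : ℕ∞) (fun z => (G z).det) Ω := by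
    simp only [Matrix.det_apply]
    refine ContDiffOn.sum fun σ _ => ContDiffOn.const_smul _ ?_
    exact contDiffOn_prod fun k _ => hG _ _
  intro x y
  have hadj : ContDiffOn ℝ (⊤ : ℕ∞) (fun z => (G z).adjugate x y) Ω := by
    simp only [Matrix.adjugate_apply, Matrix.det_apply]
    refine ContDiffOn.sum fun σ _ => ContDiffOn.const_smul _ ?_
    refine contDiffOn_prod fun k _ => ?_
    simp only [Matrix.updateRow_apply]
    split_ifs
    · exact contDiffOn_const
    · exact hG _ _
  have hne : ∀ z ∈ Ω, (G z).det ≠ 0 := fun z hz =>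
    ((Matrix.isUnit_iff_isUnit_det _).1 (IsUnit.of_mul_eq_one _ (mul_eq_one_comm.1 (hKG z hz)))).ne_zero
  refine (hadj.mul (hdet.inv hne)).congr fun z hz => ?_
  have : K z = (G z)⁻¹ := (Matrix.inv_eq_left_inv (hKG z hz)).symm
  rw [this, Matrix.inv_def, Matrix.smul_apply, Ring.inverse_eq_inv', smul_eq_mul, mul_comm]
  rfl

/-- The second derivatives of `tr (K F H F^*)`. -/
theorem trace_second {K : (Fin m → ℂ) → Matrix (Fin a) (Fin a) ℂ}
    {F : (Fin m → ℂ) → Matrix (Fin a) (Fin b) ℂ} {H : (Fin m → ℂ) → Matrix (Fin b) (Fin b) ℂ}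
    (hK : Sm Ω K) (hF : Hol Ω F) (hH : Sm Ω H) (hΩ : IsOpen Ω) (hz : z ∈ Ω) (i j : Fin m)
    (u : (Fin m → ℂ) → ℂ)
    (hu : ∀ z ∈ Ω, u z = (K z * F z * H z * (F z).conjTranspose).trace) :
    W (-Complex.I) i (W Complex.I j u) z =
      ((MW (-Complex.I) i (MW Complex.I j K) z * F z + MW Complex.I j K z * MW (-Complex.I) i F z)
          * H z * (F z).conjTranspose
        + MW Complex.I j K z * F z * MW (-Complex.I) i H z * (F z).conjTranspose
        + ((MW (-Complex.I) i K z * F z + K z * MW (-Complex.I) i F z) * MW Complex.I j H z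
          + K z * F z * MW (-Complex.I) i (MW Complex.I j H) z) * (F z).conjTranspose
        + ((MW (-Complex.I) i K z * F z + K z * MW (-Complex.I) i F z) * H z
          + K z * F z * MW (-Complex.I) i H z) * (MW (-Complex.I) j F z).conjTranspose).trace := by
  have sF := hF.sm hΩ
  have sFs := sF.conj
  have h1 : Set.EqOn (W Complex.I j u) (fun z =>
      (MW Complex.I j K z * F z * H z * (F z).conjTranspose
        + K z * F z * MW Complex.I j H z * (F z).conjTranspose
        + K z * F z * H z * (MW (-Complex.I) j F z).conjTranspose).trace) Ω := by
    intro z hz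
    rw [W_congr Complex.I j hΩ hz hu, MW_trace _ _ (((hK.mul sF).mul hH).mul sFs) hΩ hz,
      MW_mul _ _ ((hK.mul sF).mul hH) sFs hΩ hz, MW_mul _ _ (hK.mul sF) hH hΩ hz,
      MW_mul _ _ hK sF hΩ hz, MW_holo j hF hΩ hz, MW_conj]
    have : star Complex.I = -Complex.I := by simp
    rw [this, Matrix.mul_zero, add_zero, Matrix.add_mul]
  have s2 := hK.MW Complex.I j hΩ
  have sH2 := hH.MW Complex.I j hΩ
  have hF1 := hF.MW j hΩ
  have sF1 := (hF1.sm hΩ).conj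
  have q1 := ((s2.mul sF).mul hH).mul sFs
  have q2 := ((hK.mul sF).mul sH2).mul sFs
  have q3 := ((hK.mul sF).mul hH).mul sF1
  rw [W_congr _ i hΩ hz h1, MW_trace _ _ ((q1.add q2).add q3) hΩ hz,
    MW_add _ _ (q1.add q2) q3 hΩ hz, MW_add _ _ q1 q2 hΩ hz,
    MW_mul _ _ ((s2.mul sF).mul hH) sFs hΩ hz, MW_mul _ _ (s2.mul sF) hH hΩ hz,
    MW_mul _ _ s2 sF hΩ hz,
    MW_mul _ _ ((hK.mul sF).mul sH2) sFs hΩ hz, MW_mul _ _ (hK.mul sF) sH2 hΩ hz,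
    MW_mul _ _ ((hK.mul sF).mul hH) sF1 hΩ hz, MW_mul _ _ (hK.mul sF) hH hΩ hz,
    MW_mul _ _ hK sF hΩ hz, MW_conj_holo i hF hΩ hz, MW_conj_holo i hF1 hΩ hz]
  simp only [Matrix.mul_zero, add_zero, Matrix.add_mul]

end Mat

/-- The matrix algebra behind the Schwarz calculation. -/
theorem matrix_identity {a b : ℕ} (K G1 G2 G12 : Matrix (Fin a) (Fin a) ℂ)
    (F F1 : Matrix (Fin a) (Fin b) ℂ) (Fs Fs2 : Matrix (Fin b) (Fin a) ℂ)
    (H H1 H2 H12 L : Matrix (Fin b) (Fin b) ℂ) (hHL : H * L = 1) :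
    (((K * G1 * K * G2 * K + K * G2 * K * G1 * K - K * G12 * K) * F + -(K * G2 * K) * F1)
          * H * Fs
        + -(K * G2 * K) * F * H1 * Fs
        + ((-(K * G1 * K) * F + K * F1) * H2 + K * F * H12) * Fs
        + ((-(K * G1 * K) * F + K * F1) * H + K * F * H1) * Fs2).trace
    = (K * (F1 - G1 * K * F + F * (H1 * L)) * H * (Fs2 - Fs * K * G2 + L * H2 * Fs)).trace
      + (K * (-G12 + G1 * K * G2) * K * F * H * Fs).trace
      - (K * F * (-H12 + H1 * L * H2) * Fs).trace := by
  have hLH : L * H = 1 := mul_eq_one_comm.1 hHL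
  have e1 : ∀ {c : ℕ} (X : Matrix (Fin b) (Fin c) ℂ), H * (L * X) = X := fun X => by
    rw [← Matrix.mul_assoc, hHL, Matrix.one_mul]
  have e2 : ∀ {c : ℕ} (X : Matrix (Fin b) (Fin c) ℂ), L * (H * X) = X := fun X => by
    rw [← Matrix.mul_assoc, hLH, Matrix.one_mul]
  have t : ∀ X : Matrix (Fin a) (Fin a) ℂ, (K * (X * (K * G2))).trace
      = (K * (G2 * (K * X))).trace := by
    intro X
    rw [← Matrix.mul_assoc, Matrix.trace_mul_comm]
    simp only [Matrix.mul_assoc]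
  have t1 := t (F1 * (H * Fs))
  have t2 := t (G1 * (K * (F * (H * Fs))))
  have t3 := t (F * (H1 * Fs))
  simp only [Matrix.mul_assoc] at t1 t2 t3
  simp only [Matrix.add_mul, Matrix.mul_add, Matrix.sub_mul, Matrix.mul_sub, Matrix.neg_mul,
    Matrix.mul_neg, Matrix.mul_assoc, Matrix.trace_add, Matrix.trace_sub, Matrix.trace_neg, e1, e2,
    t1, t2, t3]
  ring

section Sums
variable {a b c d : ℕ}

theorem trace4 (A : Matrix (Fin a) (Fin a) ℂ) (B : Matrix (Fin a) (Fin b) ℂ)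
    (C : Matrix (Fin b) (Fin b) ℂ) (D : Matrix (Fin b) (Fin a) ℂ) :
    (A * B * C * D).trace = ∑ p, ∑ q, ∑ α, ∑ β, A q p * B p α * C α β * D β q := by
  simp only [Matrix.trace, Matrix.diag, Matrix.mul_apply, Finset.sum_mul]
  calc ∑ q, ∑ β, ∑ α, ∑ p, A q p * B p α * C α β * D β q
      = ∑ q, ∑ α, ∑ β, ∑ p, A q p * B p α * C α β * D β q :=
        Finset.sum_congr rfl fun q _ => Finset.sum_comm
    _ = ∑ q, ∑ p, ∑ α, ∑ β, A q p * B p α * C α β * D β q :=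
        Finset.sum_congr rfl fun q _ => (Finset.sum_congr rfl fun α _ => Finset.sum_comm).trans
          Finset.sum_comm
    _ = _ := Finset.sum_comm

theorem sum4_comm {κ : Type*} [Fintype κ] (X : Fin a → Fin b → Fin c → Fin d → κ → ℂ) :
    ∑ p, ∑ q, ∑ α, ∑ β, ∑ k, X p q α β k = ∑ k, ∑ p, ∑ q, ∑ α, ∑ β, X p q α β k :=
  (Finset.sum_congr rfl fun _ _ => (Finset.sum_congr rfl fun _ _ =>
    (Finset.sum_congr rfl fun _ _ => Finset.sum_comm).trans Finset.sum_comm).trans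
      Finset.sum_comm).trans Finset.sum_comm

theorem sum22_comm (X : Fin a → Fin b → Fin c → Fin d → ℂ) :
    ∑ p, ∑ q, ∑ α, ∑ β, X p q α β = ∑ α, ∑ β, ∑ p, ∑ q, X p q α β := by
  calc ∑ p, ∑ q, ∑ α, ∑ β, X p q α β = ∑ p, ∑ α, ∑ β, ∑ q, X p q α β :=
        Finset.sum_congr rfl fun p _ => Finset.sum_comm.trans
          (Finset.sum_congr rfl fun α _ => Finset.sum_comm)
    _ = _ := Finset.sum_comm.trans (Finset.sum_congr rfl fun α _ => Finset.sum_comm)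

theorem trace6 (K R : Matrix (Fin a) (Fin a) ℂ) (F : Matrix (Fin a) (Fin b) ℂ)
    (H : Matrix (Fin b) (Fin b) ℂ) (Fs : Matrix (Fin b) (Fin a) ℂ) :
    (K * R * K * F * H * Fs).trace = ∑ k, ∑ l, ∑ p, ∑ q, ∑ α, ∑ β,
      R k l * K q k * K l p * H α β * F p α * Fs β q := by
  rw [trace4]
  simp only [Matrix.mul_apply, Finset.sum_mul]
  rw [sum4_comm]
  rw [Finset.sum_congr rfl fun k _ => sum4_comm _, Finset.sum_comm]
  refine Finset.sum_congr rfl fun k _ => Finset.sum_congr rfl fun l _ =>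
    Finset.sum_congr rfl fun p _ => Finset.sum_congr rfl fun q _ => Finset.sum_congr rfl fun α _ =>
    Finset.sum_congr rfl fun β _ => ?_
  ring

theorem traceR (K : Matrix (Fin a) (Fin a) ℂ) (F : Matrix (Fin a) (Fin b) ℂ)
    (H : Matrix (Fin b) (Fin b) ℂ) (Fs : Matrix (Fin b) (Fin a) ℂ)
    (X : Fin b → Fin b → Fin b → Fin b → ℂ) (Y : Fin b → Fin b → ℂ)
    (hH : ∀ γ δ, H γ δ = ∑ α, ∑ β, X α β γ δ * Y α β) :
    (K * F * H * Fs).trace = ∑ α, ∑ β, ∑ γ, ∑ δ, X α β γ δ * Y α β *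
      ∑ p, ∑ q, K q p * F p γ * Fs δ q := by
  rw [trace4, sum22_comm, sum22_comm (fun α β γ δ => X α β γ δ * Y α β *
      ∑ p, ∑ q, K q p * F p γ * Fs δ q)]
  refine Finset.sum_congr rfl fun γ _ => Finset.sum_congr rfl fun δ _ => ?_
  simp only [← Finset.sum_mul, ← hH]
  simp only [Finset.mul_sum]
  refine Finset.sum_congr rfl fun p _ => Finset.sum_congr rfl fun q _ => ?_
  ring

/-- Contraction of a `(1,1)`-form. -/
def ctr (gi : Fin a → Fin b → ℂ) (X : Fin a → Fin b → ℂ) : ℂ := ∑ i, ∑ j, gi i j * X i j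

theorem ctr_sum {κ : Type*} [Fintype κ] (gi : Fin a → Fin b → ℂ) (X : Fin a → Fin b → κ → ℂ) :
    ctr gi (fun i j => ∑ k, X i j k) = ∑ k, ctr gi (fun i j => X i j k) := by
  simp only [ctr, Finset.mul_sum]
  exact (Finset.sum_congr rfl fun _ _ => Finset.sum_comm).trans Finset.sum_comm

theorem ctr_mul (gi : Fin a → Fin b → ℂ) (X : Fin a → Fin b → ℂ) (y : ℂ) :
    ctr gi (fun i j => X i j * y) = ctr gi X * y := by
  simp only [ctr, Finset.sum_mul, mul_assoc]

theorem mul_ctr (gi : Fin a → Fin b → ℂ) (X : Fin a → Fin b → ℂ) (y : ℂ) :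
    ctr gi (fun i j => y * X i j) = y * ctr gi X := by
  simp only [ctr, Finset.mul_sum, mul_left_comm]

theorem ctr_add (gi : Fin a → Fin b → ℂ) (X Y : Fin a → Fin b → ℂ) :
    ctr gi (fun i j => X i j + Y i j) = ctr gi X + ctr gi Y := by
  simp only [ctr, mul_add, Finset.sum_add_distrib]

theorem ctr_sub (gi : Fin a → Fin b → ℂ) (X Y : Fin a → Fin b → ℂ) :
    ctr gi (fun i j => X i j - Y i j) = ctr gi X - ctr gi Y := by
  simp only [ctr, mul_sub, Finset.sum_sub_distrib]

end Sums

section Comp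
variable {m n : ℕ} {Ω : Set (Fin m → ℂ)} {D : Set (Fin n → ℂ)} {z : Fin m → ℂ}
  {f : (Fin m → ℂ) → Fin n → ℂ} {φ : (Fin n → ℂ) → ℂ}

theorem comp_hol (hf : DifferentiableOn ℂ f Ω) (α : Fin n) :
    DifferentiableOn ℂ (fun z => f z α) Ω := differentiableOn_pi.1 hf α

theorem dz_comp (hΩ : IsOpen Ω) (hD : IsOpen D) (hf : DifferentiableOn ℂ f Ω)
    (hfD : Set.MapsTo f Ω D) (hφ : ContDiffOn ℝ (⊤ : ℕ∞) φ D) (hz : z ∈ Ω) (i : Fin m) :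
    W (-Complex.I) i (fun z => φ (f z)) z = ∑ a, W (-Complex.I) a φ (f z) * fd f a i z := by
  have h0 := hf.differentiableAt (hΩ.mem_nhds hz)
  rw [W_comp _ i h0 ((hφ.differentiableOn (by simp)).differentiableAt (hD.mem_nhds (hfD hz)))]
  refine Finset.sum_congr rfl fun a _ => ?_
  have h2 : star (-Complex.I) = Complex.I := by simp
  rw [W_star, h2, W_bar_holo i ((comp_hol hf a).differentiableAt (hΩ.mem_nhds hz)), fd, dz_eq]
  simp

theorem dzbar_comp (hΩ : IsOpen Ω) (hD : IsOpen D) (hf : DifferentiableOn ℂ f Ω)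
    (hfD : Set.MapsTo f Ω D) (hφ : ContDiffOn ℝ (⊤ : ℕ∞) φ D) (hz : z ∈ Ω) (i : Fin m) :
    W Complex.I i (fun z => φ (f z)) z = ∑ a, W Complex.I a φ (f z) * star (fd f a i z) := by
  have h0 := hf.differentiableAt (hΩ.mem_nhds hz)
  rw [W_comp _ i h0 ((hφ.differentiableOn (by simp)).differentiableAt (hD.mem_nhds (hfD hz)))]
  refine Finset.sum_congr rfl fun a _ => ?_
  have h2 : star Complex.I = -Complex.I := by simp
  rw [W_star, h2, W_bar_holo i ((comp_hol hf a).differentiableAt (hΩ.mem_nhds hz)), fd, dz_eq]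
  simp

theorem fd_hol (hΩ : IsOpen Ω) (hf : DifferentiableOn ℂ f Ω) (α : Fin n) (i : Fin m) :
    DifferentiableOn ℂ (fd f α i) Ω := by
  have := W_holo_holo i hΩ (comp_hol hf α)
  rwa [← dz_eq] at this

theorem smooth_comp (hΩ : IsOpen Ω) (hf : DifferentiableOn ℂ f Ω)
    (hfD : Set.MapsTo f Ω D) (hφ : ContDiffOn ℝ (⊤ : ℕ∞) φ D) :
    ContDiffOn ℝ (⊤ : ℕ∞) (fun z => φ (f z)) Ω :=
  hφ.comp (contDiffOn_pi.2 fun α => holo_smooth hΩ (comp_hol hf α)) hfD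

theorem dz_dzbar_comp (hΩ : IsOpen Ω) (hD : IsOpen D) (hf : DifferentiableOn ℂ f Ω)
    (hfD : Set.MapsTo f Ω D) (hφ : ContDiffOn ℝ (⊤ : ℕ∞) φ D) (hz : z ∈ Ω) (i j : Fin m) :
    W (-Complex.I) i (W Complex.I j (fun z => φ (f z))) z
      = ∑ α, ∑ β, W (-Complex.I) α (W Complex.I β φ) (f z)
          * (fd f α i z * star (fd f β j z)) := by
  have hd : ∀ {ψ : (Fin m → ℂ) → ℂ}, ContDiffOn ℝ (⊤ : ℕ∞) ψ Ω → DifferentiableAt ℝ ψ z :=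
    fun h => (h.differentiableOn (by simp)).differentiableAt (hΩ.mem_nhds hz)
  have sφ : ∀ β, ContDiffOn ℝ (⊤ : ℕ∞) (W Complex.I β φ) D := fun β => W_smooth _ β hD hφ
  have d1 : ∀ β, DifferentiableAt ℝ (fun z => W Complex.I β φ (f z)) z := fun β =>
    hd (smooth_comp hΩ hf hfD (sφ β))
  have d2 : ∀ β, DifferentiableAt ℝ (fun z => star (fd f β j z)) z := fun β =>
    (hd (holo_smooth hΩ (fd_hol hΩ hf β j))).star
  rw [W_congr _ i hΩ hz (fun z' hz' => dzbar_comp hΩ hD hf hfD hφ hz' j),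
    W_sum _ _ _ (fun β _ => (d1 β).fun_mul (d2 β)), Finset.sum_comm]
  refine Finset.sum_congr rfl fun β _ => ?_
  rw [W_mul _ _ (d1 β) (d2 β), dz_comp hΩ hD hf hfD (sφ β) hz i, W_star]
  have h2 : star (-Complex.I) = Complex.I := by simp
  rw [h2, W_bar_holo i ((fd_hol hΩ hf β j).differentiableAt (hΩ.mem_nhds hz)), star_zero,
    mul_zero, add_zero, Finset.sum_mul]
  refine Finset.sum_congr rfl fun α _ => ?_
  ring

/-- The star of a Christoffel type derivative. -/
theorem star_dz_herm (hΩ : IsOpen Ω)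
    {h : (Fin m → ℂ) → Matrix (Fin n) (Fin n) ℂ}
    (hh : ∀ z ∈ Ω, (h z).conjTranspose = h z) (hz : z ∈ Ω) (j : Fin m) :
    (MW (-Complex.I) j h z).conjTranspose = MW Complex.I j h z := by
  have h2 : star Complex.I = -Complex.I := by simp
  rw [← h2, ← MW_conj]
  exact MW_congr _ _ hΩ hz hh

end Comp

theorem inv_herm {a : ℕ} {K G : Matrix (Fin a) (Fin a) ℂ} (h : G * K = 1)
    (hG : G.conjTranspose = G) : K.conjTranspose = K := by
  have h1 : K.conjTranspose * G = 1 := by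
    have := congrArg Matrix.conjTranspose h
    rwa [Matrix.conjTranspose_mul, hG, Matrix.conjTranspose_one] at this
  exact left_inv_eq_right_inv h1 h

/-- **Lemma 4.1.**  Let `f : (M, g) → (N, h)` be a holomorphic map between Hermitian
manifolds and set `u = tr_{ω_g}(f^*ω_h)`.  Then, in local holomorphic coordinates,
`∂∂̄ u = ⟨∇df, ∇df⟩
   + ( R^g_{i j̄ k l̄} g^{k q̄} g^{p l̄} h_{α β̄} f^α_p \overline{f^β_q}
       − R^h_{α β̄ γ δ̄} (f^α_i \overline{f^β_j}) (g^{p q̄} f^γ_p \overline{f^δ_q}) )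
     dz^i ∧ dz̄^j`
and
`Δ_g u = |∇df|² + (g^{i j̄} R^g_{i j̄ k l̄}) g^{k q̄} g^{p l̄} h_{α β̄} f^α_p \overline{f^β_q}
   − R^h_{α β̄ γ δ̄} (g^{i j̄} f^α_i \overline{f^β_j}) (g^{p q̄} f^γ_p \overline{f^δ_q})`. -/
theorem schwarz_identities {m n : ℕ}
    (Ω : Set (Fin m → ℂ)) (hΩ : IsOpen Ω)
    (D : Set (Fin n → ℂ)) (hD : IsOpen D)
    -- the holomorphic map
    (f : (Fin m → ℂ) → Fin n → ℂ)
    (hf : DifferentiableOn ℂ f Ω) (hfD : Set.MapsTo f Ω D)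
    -- the Hermitian metric g on the source, and its inverse
    (g gInv : (Fin m → ℂ) → Fin m → Fin m → ℂ)
    (hg_smooth : ∀ k l, ContDiffOn ℝ (⊤ : ℕ∞) (fun z => g z k l) Ω)
    (hg_herm : ∀ z ∈ Ω, ∀ k l, g z k l = star (g z l k))
    (hg_pos : ∀ z ∈ Ω, ∀ v : Fin m → ℂ, v ≠ 0 →
      0 < (∑ k, ∑ l, g z k l * v k * star (v l)).re)
    (hg_inv : ∀ z ∈ Ω, ∀ i k, (∑ j, g z i j * gInv z k j) = if i = k then 1 else 0)
    -- the Hermitian metric h on the target, and its inverse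
    (h hInv : (Fin n → ℂ) → Fin n → Fin n → ℂ)
    (hh_smooth : ∀ α β, ContDiffOn ℝ (⊤ : ℕ∞) (fun w => h w α β) D)
    (hh_herm : ∀ w ∈ D, ∀ α β, h w α β = star (h w β α))
    (hh_pos : ∀ w ∈ D, ∀ v : Fin n → ℂ, v ≠ 0 →
      0 < (∑ α, ∑ β, h w α β * v α * star (v β)).re)
    (hh_inv : ∀ w ∈ D, ∀ α γ, (∑ β, h w α β * hInv w γ β) = if α = γ then 1 else 0) :
    ∀ z ∈ Ω,
      -- the identity for `∂∂̄ u`, componentwise in `dz^i ∧ dz̄^j`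
      (∀ i j : Fin m,
        dz i (fun z' => dzbar j (energy gInv h f) z') z
          = nablaDfSq g gInv h hInv f i j z
            + (∑ k, ∑ l, ∑ p, ∑ q, ∑ α, ∑ β,
                chern g gInv i j k l z * gInv z k q * gInv z p l * h (f z) α β
                  * fd f α p z * star (fd f β q z))
            - (∑ α, ∑ β, ∑ γ, ∑ δ,
                chern h hInv α β γ δ (f z) * (fd f α i z * star (fd f β j z))
                  * (∑ p, ∑ q, gInv z p q * fd f γ p z * star (fd f δ q z)))) ∧
      -- the identity for `Δ_g u`
      ((∑ i, ∑ j, gInv z i j * dz i (fun z' => dzbar j (energy gInv h f) z') z)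
          = (∑ i, ∑ j, gInv z i j * nablaDfSq g gInv h hInv f i j z)
            + (∑ k, ∑ l, ∑ p, ∑ q, ∑ α, ∑ β,
                (∑ i, ∑ j, gInv z i j * chern g gInv i j k l z)
                  * gInv z k q * gInv z p l * h (f z) α β
                  * fd f α p z * star (fd f β q z))
            - (∑ α, ∑ β, ∑ γ, ∑ δ,
                chern h hInv α β γ δ (f z)
                  * (∑ i, ∑ j, gInv z i j * fd f α i z * star (fd f β j z))
                  * (∑ p, ∑ q, gInv z p q * fd f γ p z * star (fd f δ q z)))) := by
  intro z hz
  set G : (Fin m → ℂ) → Matrix (Fin m) (Fin m) ℂ := fun z => Matrix.of (g z) with hG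
  set K : (Fin m → ℂ) → Matrix (Fin m) (Fin m) ℂ := fun z => Matrix.of fun q p => gInv z p q with hK
  set F : (Fin m → ℂ) → Matrix (Fin m) (Fin n) ℂ := fun z => Matrix.of fun p α => fd f α p z with hF
  set H : (Fin m → ℂ) → Matrix (Fin n) (Fin n) ℂ := fun z => Matrix.of (h (f z)) with hH
  set L : (Fin m → ℂ) → Matrix (Fin n) (Fin n) ℂ := fun z => Matrix.of fun q p => hInv (f z) p q
    with hL
  have hGK : ∀ z ∈ Ω, G z * K z = 1 := by
    intro z hz; ext x y
    simp only [G, K, Matrix.mul_apply, Matrix.of_apply, hg_inv z hz, Matrix.one_apply]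
  have hKG : ∀ z ∈ Ω, K z * G z = 1 := fun z hz => mul_eq_one_comm.1 (hGK z hz)
  have hHL : ∀ z ∈ Ω, H z * L z = 1 := by
    intro z hz; ext x y
    simp only [H, L, Matrix.mul_apply, Matrix.of_apply, hh_inv _ (hfD hz), Matrix.one_apply]
  have hGh : ∀ z ∈ Ω, (G z).conjTranspose = G z := by
    intro z hz; ext x y
    simp only [G, Matrix.conjTranspose_apply, Matrix.of_apply]; exact (hg_herm z hz x y).symm
  have hHh : ∀ z ∈ Ω, (H z).conjTranspose = H z := by
    intro z hz; ext x y
    simp only [H, Matrix.conjTranspose_apply, Matrix.of_apply]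
    exact (hh_herm _ (hfD hz) x y).symm
  have hKh := inv_herm (hGK z hz) (hGh z hz)
  have hLh := inv_herm (hHL z hz) (hHh z hz)
  have sG : Sm Ω G := hg_smooth
  have sK : Sm Ω K := Sm_inv sG hKG
  have sH : Sm Ω H := fun x y => smooth_comp hΩ hf hfD (hh_smooth x y)
  have hFh : Hol Ω F := fun p α => fd_hol hΩ hf α p
  have hu : ∀ z ∈ Ω, energy gInv h f z = (K z * F z * H z * (F z).conjTranspose).trace := by
    intro z hz
    rw [trace4]
    simp only [energy, K, F, H, Matrix.conjTranspose_apply, Matrix.of_apply]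
    refine Finset.sum_congr rfl fun p _ => Finset.sum_congr rfl fun q _ =>
      Finset.sum_congr rfl fun α _ => Finset.sum_congr rfl fun β _ => ?_
    ring
  -- the matrix of the covariant derivative
  have hN : ∀ i, Matrix.of (fun p α => nablaDf g gInv h hInv f α i p z)
      = MW (-Complex.I) i F z - MW (-Complex.I) i G z * K z * F z
        + F z * (MW (-Complex.I) i H z * L z) := by
    intro i
    ext p α
    simp only [nablaDf, christoffel, Matrix.add_apply, Matrix.sub_apply, Matrix.of_apply, dz_eq]
    congr 1
    · congr 1
      simp only [Matrix.mul_apply]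
      refine Finset.sum_congr rfl fun k _ => ?_
      congr 1
      refine Finset.sum_congr rfl fun l _ => ?_
      exact mul_comm _ _
    · simp only [Matrix.mul_apply]
      rw [Finset.sum_comm]
      refine Finset.sum_congr rfl fun δ _ => ?_
      have e : ∀ l, MW (-Complex.I) i H z δ l
          = ∑ γ, W (-Complex.I) γ (fun w => h w δ l) (f z) * fd f γ i z := fun l =>
        dz_comp hΩ hD hf hfD (hh_smooth δ l) hz i
      simp only [e, Finset.sum_mul, Finset.mul_sum]
      rw [Finset.sum_comm]
      refine Finset.sum_congr rfl fun l _ => Finset.sum_congr rfl fun γ _ => ?_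
      simp only [F, L, Matrix.of_apply]
      ring
  have key : ∀ i j : Fin m,
        dz i (fun z' => dzbar j (energy gInv h f) z') z
          = nablaDfSq g gInv h hInv f i j z
            + (∑ k, ∑ l, ∑ p, ∑ q, ∑ α, ∑ β,
                chern g gInv i j k l z * gInv z k q * gInv z p l * h (f z) α β
                  * fd f α p z * star (fd f β q z))
            - (∑ α, ∑ β, ∑ γ, ∑ δ,
                chern h hInv α β γ δ (f z) * (fd f α i z * star (fd f β j z))
                  * (∑ p, ∑ q, gInv z p q * fd f γ p z * star (fd f δ q z))) := by
    intro i j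
    have hNs : (Matrix.of (fun p α => nablaDf g gInv h hInv f α j p z)).conjTranspose
        = (MW (-Complex.I) j F z).conjTranspose - (F z).conjTranspose * K z * MW Complex.I j G z
          + L z * MW Complex.I j H z * (F z).conjTranspose := by
      rw [hN j]
      simp only [Matrix.conjTranspose_add, Matrix.conjTranspose_sub, Matrix.conjTranspose_mul,
        star_dz_herm hΩ hGh hz, star_dz_herm hΩ hHh hz, hKh, hLh, Matrix.mul_assoc]
    have e1 : dz i (fun z' => dzbar j (energy gInv h f) z') z
        = W (-Complex.I) i (W Complex.I j (energy gInv h f)) z := by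
      rw [dz_eq, dzbar_eq]
    have e2 : nablaDfSq g gInv h hInv f i j z
        = (K z * Matrix.of (fun p α => nablaDf g gInv h hInv f α i p z) * H z
          * (Matrix.of (fun p α => nablaDf g gInv h hInv f α j p z)).conjTranspose).trace := by
      rw [trace4]
      simp only [nablaDfSq, K, H, Matrix.conjTranspose_apply, Matrix.of_apply]
      refine Finset.sum_congr rfl fun p _ => Finset.sum_congr rfl fun q _ =>
        Finset.sum_congr rfl fun α _ => Finset.sum_congr rfl fun β _ => ?_
      ring
    have eR : ∀ k l, (-MW (-Complex.I) i (MW Complex.I j G) z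
        + MW (-Complex.I) i G z * K z * MW Complex.I j G z) k l = chern g gInv i j k l z := by
      intro k l
      simp only [chern, dz_eq, dzbar_eq, Matrix.add_apply, Matrix.neg_apply]
      congr 1
      simp only [Matrix.mul_apply, Finset.sum_mul]
      refine Finset.sum_congr rfl fun p _ => Finset.sum_congr rfl fun q _ => ?_
      simp only [K, G, MW, Matrix.of_apply]
      ring
    have eRh : ∀ γ δ, (-MW (-Complex.I) i (MW Complex.I j H) z
        + MW (-Complex.I) i H z * L z * MW Complex.I j H z) γ δ
        = ∑ α, ∑ β, chern h hInv α β γ δ (f z) * (fd f α i z * star (fd f β j z)) := by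
      intro γ δ
      have a1 : MW (-Complex.I) i (MW Complex.I j H) z γ δ = _ :=
        dz_dzbar_comp hΩ hD hf hfD (hh_smooth γ δ) hz i j
      have a2 : ∀ l, MW (-Complex.I) i H z γ l
          = ∑ α, W (-Complex.I) α (fun w => h w γ l) (f z) * fd f α i z := fun l =>
        dz_comp hΩ hD hf hfD (hh_smooth γ l) hz i
      have a3 : ∀ l, MW Complex.I j H z l δ
          = ∑ β, W Complex.I β (fun w => h w l δ) (f z) * star (fd f β j z) := fun l =>
        dzbar_comp hΩ hD hf hfD (hh_smooth l δ) hz j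
      have a4 : (MW (-Complex.I) i H z * L z * MW Complex.I j H z) γ δ
          = ∑ α, ∑ β, (∑ p, ∑ q, hInv (f z) p q * W (-Complex.I) α (fun w => h w γ q) (f z)
              * W Complex.I β (fun w => h w p δ) (f z)) * (fd f α i z * star (fd f β j z)) := by
        simp only [Matrix.mul_apply, a2, a3, Finset.sum_mul, Finset.mul_sum]
        rw [sum22_comm]
        rw [Finset.sum_comm]
        refine Finset.sum_congr rfl fun α _ => ((Finset.sum_comm.trans (Finset.sum_congr rfl
          fun p _ => Finset.sum_comm)).trans Finset.sum_comm).trans ?_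
        refine (Finset.sum_congr rfl fun β _ =>
          Finset.sum_congr rfl fun p _ => Finset.sum_congr rfl fun q _ => ?_)
        simp only [L, Matrix.of_apply]
        ring
      rw [Matrix.add_apply, Matrix.neg_apply, a1, a4]
      simp only [chern, dz_eq, dzbar_eq, add_mul, neg_mul, Finset.sum_add_distrib,
        Finset.sum_neg_distrib]
    rw [e1, trace_second sK hFh sH hΩ hz i j _ hu, MW_inv2 _ _ sK sG hKG hΩ hz,
      MW_inv _ _ sK sG hKG hΩ hz, MW_inv _ _ sK sG hKG hΩ hz,
      matrix_identity _ _ _ _ _ _ _ _ _ _ _ _ (L z) (hHL z hz), e2, hNs, hN i, trace6,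
      traceR _ _ _ _ _ _ eRh]
    simp only [eR]
    rfl
  refine ⟨key, ?_⟩
  have k2 : (fun i j => dz i (fun z' => dzbar j (energy gInv h f) z') z) = _ :=
    funext fun i => funext fun j => key i j
  have k3 := congrArg (ctr (gInv z)) k2
  rw [ctr_sub, ctr_add] at k3
  simp only [ctr_sum, ctr_mul, mul_ctr] at k3
  simp only [ctr, ← mul_assoc] at k3 ⊢
  exact k3

end YauSchwarz
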